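/- (Lemma 8, cross-moment equalities.) Writing ∬ g for ∫_{ℝ^d}∫_{ℝ^d} g(x,y) dN(m₀,Σ₀)(x) dN(m₀,Σ₀)(y), the following equalities hold: ∬ T₂² = ∬ T₃² = ∬ T₁T₂ = ∬ T₁T₃, and ∬ T₄² = ∬ T₁T₄ = ∬ T₂T₃ = ∬ T₂T₄ = ∬ T₃T₄. -/

import Mathlib

open MeasureTheory Matrix Real

/-- The Gaussian probability measure `N(m, Σ)` on `ℝ^d`, given by its density
`(2π)^{-d/2} det(Σ)^{-1/2} exp(-(x-m)ᵀ Σ⁻¹ (x-m) / 2)` with respect to Lebesgue measure. -/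
noncomputable def gaussN {d : ℕ} (m : Fin d → ℝ) (S : Matrix (Fin d) (Fin d) ℝ) :
    Measure (Fin d → ℝ) :=
  MeasureTheory.volume.withDensity fun x =>
    ENNReal.ofReal ((2 * π) ^ (-(d : ℝ) / 2) * S.det ^ (-(1 : ℝ) / 2) *
      Real.exp (-((x - m) ⬝ᵥ (S⁻¹ *ᵥ (x - m))) / 2))

/-- `V = I_d + 2σΣ₀`. -/
noncomputable def Vm {d : ℕ} (σ : ℝ) (S : Matrix (Fin d) (Fin d) ℝ) :
    Matrix (Fin d) (Fin d) ℝ :=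
  1 + (2 * σ) • S

/-- `B(x) = (x−m₀)(x−m₀)ᵀ − Σ₀`. -/
noncomputable def Bm {d : ℕ} (m₀ : Fin d → ℝ) (S : Matrix (Fin d) (Fin d) ℝ)
    (x : Fin d → ℝ) : Matrix (Fin d) (Fin d) ℝ :=
  vecMulVec (x - m₀) (x - m₀) - S

/-- `T₁(x,y) = exp(−σ‖x−y‖²)`. -/
noncomputable def T1 {d : ℕ} (σ : ℝ) (x y : Fin d → ℝ) : ℝ :=
  Real.exp (-σ * ((x - y) ⬝ᵥ (x - y)))

/-- `T₂(x,y) = det(V)^{−1/2} exp(−σ(x−m₀)ᵀV⁻¹(x−m₀)) ·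
(1 + 2σ(x−m₀)ᵀV⁻¹(y−m₀) + σ tr[V⁻¹(2σ(B(x)+Σ₀)V⁻¹ − I_d)B(y)])`. -/
noncomputable def T2 {d : ℕ} (σ : ℝ) (m₀ : Fin d → ℝ) (S : Matrix (Fin d) (Fin d) ℝ)
    (x y : Fin d → ℝ) : ℝ :=
  (Vm σ S).det ^ (-(1 : ℝ) / 2) *
    Real.exp (-σ * ((x - m₀) ⬝ᵥ ((Vm σ S)⁻¹ *ᵥ (x - m₀)))) *
    (1 + 2 * σ * ((x - m₀) ⬝ᵥ ((Vm σ S)⁻¹ *ᵥ (y - m₀))) +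
      σ * ((Vm σ S)⁻¹ * ((2 * σ) • (Bm m₀ S x + S) * (Vm σ S)⁻¹ - 1) * Bm m₀ S y).trace)

/-- `T₃(x,y) = T₂(y,x)`. -/
noncomputable def T3 {d : ℕ} (σ : ℝ) (m₀ : Fin d → ℝ) (S : Matrix (Fin d) (Fin d) ℝ)
    (x y : Fin d → ℝ) : ℝ :=
  T2 σ m₀ S y x

/-- `T₄(x,y) = det(2V−I_d)^{−1/2} · (1 + σ tr[(2(x−m₀)(y−m₀)ᵀ − B(x) − B(y))(2V−I_d)⁻¹]
+ σ²(tr[B(x)(2V−I_d)⁻¹]·tr[B(y)(2V−I_d)⁻¹] + 2 tr[B(x)(2V−I_d)⁻¹B(y)(2V−I_d)⁻¹]))`. -/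
noncomputable def T4 {d : ℕ} (σ : ℝ) (m₀ : Fin d → ℝ) (S : Matrix (Fin d) (Fin d) ℝ)
    (x y : Fin d → ℝ) : ℝ :=
  ((2 : ℝ) • Vm σ S - 1).det ^ (-(1 : ℝ) / 2) *
    (1 + σ * (((2 : ℝ) • vecMulVec (x - m₀) (y - m₀) - Bm m₀ S x - Bm m₀ S y) *
        ((2 : ℝ) • Vm σ S - 1)⁻¹).trace +
      σ ^ 2 * ((Bm m₀ S x * ((2 : ℝ) • Vm σ S - 1)⁻¹).trace *
          (Bm m₀ S y * ((2 : ℝ) • Vm σ S - 1)⁻¹).trace +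
        2 * (Bm m₀ S x * ((2 : ℝ) • Vm σ S - 1)⁻¹ *
          Bm m₀ S y * ((2 : ℝ) • Vm σ S - 1)⁻¹).trace))

/-- `K(x,y) = T₁(x,y) − T₂(x,y) − T₃(x,y) + T₄(x,y)`. -/
noncomputable def Kf {d : ℕ} (σ : ℝ) (m₀ : Fin d → ℝ) (S : Matrix (Fin d) (Fin d) ℝ)
    (x y : Fin d → ℝ) : ℝ :=
  T1 σ x y - T2 σ m₀ S x y - T3 σ m₀ S x y + T4 σ m₀ S x y

open ProbabilityTheory

/-- The density of `gaussN m R`. -/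
noncomputable def gaussDensity {d : ℕ} (m : Fin d → ℝ) (R : Matrix (Fin d) (Fin d) ℝ)
    (x : Fin d → ℝ) : ℝ :=
  (2 * π) ^ (-(d : ℝ) / 2) * R.det ^ (-(1 : ℝ) / 2) *
    Real.exp (-((x - m) ⬝ᵥ (R⁻¹ *ᵥ (x - m))) / 2)

section Density

variable {d : ℕ} {R S : Matrix (Fin d) (Fin d) ℝ} {m m' : Fin d → ℝ}

lemma continuous_gaussDensity (m : Fin d → ℝ) (R : Matrix (Fin d) (Fin d) ℝ) :
    Continuous (gaussDensity m R) := by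
  unfold gaussDensity
  fun_prop

lemma gaussDensity_pos (hR : R.PosDef) (x : Fin d → ℝ) : 0 < gaussDensity m R x := by
  have := hR.det_pos
  unfold gaussDensity
  positivity

lemma integral_gaussN (hR : R.PosDef) (f : (Fin d → ℝ) → ℝ) :
    ∫ x, f x ∂(gaussN m R) = ∫ x, gaussDensity m R x * f x := by
  rw [show gaussN m R = volume.withDensity fun x => ENNReal.ofReal (gaussDensity m R x) from rfl,
    integral_withDensity_eq_integral_toReal_smul
      (continuous_gaussDensity m R).measurable.ennreal_ofReal (by simp)]
  simp [ENNReal.toReal_ofReal (gaussDensity_pos hR _).le]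

lemma integral_gaussDensity (m : Fin d → ℝ) (hR : R.PosDef) : ∫ x, gaussDensity m R x = 1 := by
  have h0 : ∫ x, gaussDensity m R x = ∫ x, gaussDensity 0 R x := by
    rw [← integral_add_right_eq_self _ m]
    simp [gaussDensity]
  obtain ⟨C, hC⟩ : ∃ C : Matrix (Fin d) (Fin d) ℝ, R⁻¹ = Cᵀ * C := by
    open scoped MatrixOrder in
    obtain ⟨C, hC⟩ := CStarAlgebra.nonneg_iff_eq_star_mul_self.mp hR.inv.posSemidef.nonneg
    exact ⟨C, by simpa [star_eq_conjTranspose, conjTranspose_eq_transpose_of_trivial] using hC⟩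
  have hdet : R.det⁻¹ = C.det ^ 2 := by
    rw [← Ring.inverse_eq_inv', ← det_nonsing_inv, hC, det_mul, det_transpose, sq]
  have hCdet : C.det ≠ 0 := by
    intro h
    have := inv_pos.2 hR.det_pos
    simp [hdet, h] at this
  have hpow : R.det ^ (-(1 : ℝ) / 2) = |C.det| := by
    rw [neg_div, rpow_neg hR.det_pos.le, ← inv_rpow hR.det_pos.le, hdet, ← sqrt_eq_rpow,
      sqrt_sq_eq_abs]
  have hstd : ∫ w : Fin d → ℝ, rexp (-(w ⬝ᵥ w) / 2) = (2 * π) ^ ((d : ℝ) / 2) := by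
    have : ∀ w : Fin d → ℝ, rexp (-(w ⬝ᵥ w) / 2) = ∏ i, rexp (-(1 / 2) * w i ^ 2) := by
      intro w
      rw [← exp_sum, ← Finset.mul_sum, dotProduct]
      simp only [sq]
      ring_nf
    simp_rw [this]
    rw [integral_fintype_prod_volume_eq_pow (fun x : ℝ => rexp (-(1 / 2) * x ^ 2)),
      integral_gaussian, sqrt_eq_rpow, ← rpow_natCast, ← rpow_mul (by positivity)]
    simp
    congr 1 <;> ring
  have hcomp : ∫ z : Fin d → ℝ, rexp (-((C *ᵥ z) ⬝ᵥ (C *ᵥ z)) / 2)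
      = |C.det|⁻¹ * (2 * π) ^ ((d : ℝ) / 2) := by
    have := map_matrix_volume_pi_eq_smul_volume_pi hCdet
    rw [← hstd]
    have h2 := integral_map (μ := volume) (φ := toLin' C)
      (f := fun w : Fin d → ℝ => rexp (-(w ⬝ᵥ w) / 2))
      (LinearMap.continuous_of_finiteDimensional _).aemeasurable
      (by fun_prop)
    rw [this, integral_smul_measure, ENNReal.toReal_ofReal (abs_nonneg _)] at h2
    simpa [abs_inv] using h2.symm
  rw [h0]
  simp only [gaussDensity, sub_zero, hC]
  rw [integral_const_mul]
  have : ∀ x : Fin d → ℝ, x ⬝ᵥ ((Cᵀ * C) *ᵥ x) = (C *ᵥ x) ⬝ᵥ (C *ᵥ x) := by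
    intro x
    rw [← mulVec_mulVec, dotProduct_mulVec, vecMul_transpose]
  simp_rw [this]
  rw [hcomp, hpow, neg_div, rpow_neg (by positivity)]
  have : |C.det| ≠ 0 := by simpa using hCdet
  field_simp

lemma isProbabilityMeasure_gaussN (m : Fin d → ℝ) (hR : R.PosDef) :
    IsProbabilityMeasure (gaussN m R) := by
  refine ⟨?_⟩
  rw [show gaussN m R = volume.withDensity fun x => ENNReal.ofReal (gaussDensity m R x) from rfl,
    withDensity_apply _ MeasurableSet.univ, Measure.restrict_univ,
    ← ofReal_integral_eq_lintegral_ofReal, integral_gaussDensity m hR, ENNReal.ofReal_one]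
  · exact .of_integral_ne_zero (by simp [integral_gaussDensity m hR])
  · exact .of_forall fun x => (gaussDensity_pos hR x).le

lemma integral_gaussN_tilt (hS : S.PosDef) (hR : R.PosDef) {φ : (Fin d → ℝ) → ℝ} {K : ℝ}
    (h : ∀ z, gaussDensity m S z * φ z = K * gaussDensity m' R z) (f : (Fin d → ℝ) → ℝ) :
    ∫ z, φ z * f z ∂(gaussN m S) = K * ∫ z, f z ∂(gaussN m' R) := by
  rw [integral_gaussN hS, integral_gaussN hR, ← integral_const_mul]
  congr 1 with z
  rw [← mul_assoc, h, mul_assoc]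

lemma integral_gaussN_translate (m : Fin d → ℝ) (hR : R.PosDef) (f : (Fin d → ℝ) → ℝ) :
    ∫ z, f z ∂(gaussN m R) = ∫ z, f (z + m) ∂(gaussN 0 R) := by
  rw [integral_gaussN hR, integral_gaussN hR, ← integral_add_right_eq_self _ m]
  simp [gaussDensity]

lemma integral_gaussN_neg (hR : R.PosDef) (f : (Fin d → ℝ) → ℝ) :
    ∫ z, f (-z) ∂(gaussN 0 R) = ∫ z, f z ∂(gaussN 0 R) := by
  rw [integral_gaussN hR, integral_gaussN hR,
    ← integral_neg_eq_self (fun z => gaussDensity 0 R z * f z)]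
  simp [gaussDensity, mulVec_neg]

lemma dotProduct_mulVec_comm_of_symm {M : Matrix (Fin d) (Fin d) ℝ} (hM : Mᵀ = M)
    (a b : Fin d → ℝ) : a ⬝ᵥ (M *ᵥ b) = b ⬝ᵥ (M *ᵥ a) := by
  rw [dotProduct_comm, ← vecMul_transpose, hM, dotProduct_mulVec]

lemma Matrix.PosDef.transpose_eq (hR : R.PosDef) : Rᵀ = R := by
  simpa [conjTranspose_eq_transpose_of_trivial] using hR.isHermitian.eq

lemma Matrix.PosDef.inv_mul_self (hR : R.PosDef) : R⁻¹ * R = 1 :=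
  nonsing_inv_mul _ (isUnit_iff_ne_zero.2 hR.det_pos.ne')

lemma Matrix.PosDef.mul_inv_self (hR : R.PosDef) : R * R⁻¹ = 1 :=
  mul_nonsing_inv _ (isUnit_iff_ne_zero.2 hR.det_pos.ne')

/-- Completing the square in the exponent of a Gaussian density. -/
lemma quadForm_sub_mulVec (hR : R.PosDef) (z v : Fin d → ℝ) :
    (z - R *ᵥ v) ⬝ᵥ (R⁻¹ *ᵥ (z - R *ᵥ v))
      = z ⬝ᵥ (R⁻¹ *ᵥ z) - 2 * (v ⬝ᵥ z) + v ⬝ᵥ (R *ᵥ v) := by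
  have h1 : R⁻¹ *ᵥ (R *ᵥ v) = v := by rw [mulVec_mulVec, hR.inv_mul_self, one_mulVec]
  have h2 : (R *ᵥ v) ⬝ᵥ (R⁻¹ *ᵥ z) = v ⬝ᵥ z := by
    rw [dotProduct_mulVec_comm_of_symm hR.inv.transpose_eq, h1, dotProduct_comm]
  rw [mulVec_sub, h1, sub_dotProduct, dotProduct_sub, dotProduct_sub, h2, dotProduct_comm z v,
    dotProduct_comm (R *ᵥ v) v]
  ring

lemma integral_exp_gaussN (hR : R.PosDef) (a : Fin d → ℝ) :
    ∫ z, rexp (a ⬝ᵥ z) ∂(gaussN 0 R) = rexp (a ⬝ᵥ (R *ᵥ a) / 2) := by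
  have := isProbabilityMeasure_gaussN (R *ᵥ a) hR
  have h := integral_gaussN_tilt (m := 0) (m' := R *ᵥ a) (φ := fun z => rexp (a ⬝ᵥ z))
    (K := rexp (a ⬝ᵥ (R *ᵥ a) / 2)) hR hR ?_ (fun _ => 1)
  · simpa using h
  · intro z
    simp only [gaussDensity, quadForm_sub_mulVec hR, sub_zero]
    rw [mul_left_comm, mul_assoc, ← exp_add, ← exp_add]
    ring_nf

end Density

section Moments

variable {d : ℕ} {R : Matrix (Fin d) (Fin d) ℝ}

lemma mgf_gaussN (hR : R.PosDef) (a : Fin d → ℝ) :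
    mgf (fun z => a ⬝ᵥ z) (gaussN 0 R) = fun t => rexp (a ⬝ᵥ (R *ᵥ a) / 2 * t ^ 2) := by
  ext t
  have h := integral_exp_gaussN hR (t • a)
  simp only [smul_dotProduct, mulVec_smul, dotProduct_smul, smul_eq_mul] at h
  rw [mgf, h]
  ring_nf

lemma integrableExpSet_gaussN (hR : R.PosDef) (a : Fin d → ℝ) :
    integrableExpSet (fun z => a ⬝ᵥ z) (gaussN 0 R) = Set.univ := by
  refine Set.eq_univ_of_forall fun t => ?_
  refine .of_integral_ne_zero ?_
  change mgf _ _ t ≠ 0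
  rw [mgf_gaussN hR]
  positivity

lemma integral_dotProduct_pow_gaussN (hR : R.PosDef) (a : Fin d → ℝ) (n : ℕ) :
    ∫ z, (a ⬝ᵥ z) ^ n ∂(gaussN 0 R)
      = iteratedDeriv n (fun t => rexp (a ⬝ᵥ (R *ᵥ a) / 2 * t ^ 2)) 0 := by
  rw [← mgf_gaussN hR, iteratedDeriv_mgf_zero (by simp [integrableExpSet_gaussN hR])]
  rfl

lemma iteratedDeriv_gaussian (v : ℝ) :
    iteratedDeriv 2 (fun t => rexp (v / 2 * t ^ 2)) 0 = v ∧
      iteratedDeriv 4 (fun t => rexp (v / 2 * t ^ 2)) 0 = 3 * v ^ 2 := by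
  have key : ∀ p q : ℝ → ℝ, (∀ t, HasDerivAt p (q t - v * t * p t) t) →
      deriv (fun t => p t * rexp (v / 2 * t ^ 2)) = fun t => q t * rexp (v / 2 * t ^ 2) := by
    intro p q hpq
    ext t
    have h1 : HasDerivAt (fun t => rexp (v / 2 * t ^ 2)) (rexp (v / 2 * t ^ 2) * (v * t)) t := by
      convert! (((hasDerivAt_id t).pow 2).const_mul (v / 2)).exp using 1
      simp; ring
    have h2 : HasDerivAt (fun t => p t * rexp (v / 2 * t ^ 2)) _ t := (hpq t).mul h1
    rw [h2.deriv]
    ring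
  have k1 : deriv (fun t => rexp (v / 2 * t ^ 2)) = fun t => (v * t) * rexp (v / 2 * t ^ 2) := by
    have := key (fun _ => 1) (fun t => v * t) fun t => by
      simpa using hasDerivAt_const t (1 : ℝ)
    simpa using this
  have k2 := key (fun t => v * t) (fun t => v + v ^ 2 * t ^ 2) fun t => by
    convert! (hasDerivAt_id t).const_mul v using 1
    ring
  have k3 := key (fun t => v + v ^ 2 * t ^ 2) (fun t => 3 * v ^ 2 * t + v ^ 3 * t ^ 3) fun t => by
    convert! (((hasDerivAt_id t).pow 2).const_mul (v ^ 2)).const_add v using 1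
    simp; ring
  have k4 := key (fun t => 3 * v ^ 2 * t + v ^ 3 * t ^ 3)
      (fun t => 3 * v ^ 2 + 6 * v ^ 3 * t ^ 2 + v ^ 4 * t ^ 4) fun t => by
    convert! ((hasDerivAt_id t).const_mul (3 * v ^ 2)).add
      (((hasDerivAt_id t).pow 3).const_mul (v ^ 3)) using 1
    simp; ring
  constructor <;> simp [iteratedDeriv_succ, k1, k2, k3, k4]

lemma integral_dotProduct_sq_gaussN (hR : R.PosDef) (a : Fin d → ℝ) :
    ∫ z, (a ⬝ᵥ z) ^ 2 ∂(gaussN 0 R) = a ⬝ᵥ (R *ᵥ a) := by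
  rw [integral_dotProduct_pow_gaussN hR, (iteratedDeriv_gaussian _).1]

lemma integral_dotProduct_pow_four_gaussN (hR : R.PosDef) (a : Fin d → ℝ) :
    ∫ z, (a ⬝ᵥ z) ^ 4 ∂(gaussN 0 R) = 3 * (a ⬝ᵥ (R *ᵥ a)) ^ 2 := by
  rw [integral_dotProduct_pow_gaussN hR, (iteratedDeriv_gaussian _).2]

end Moments

/-- Continuous functions of at most polynomial growth. -/
def PolyBounded {X : Type*} [NormedAddCommGroup X] (f : X → ℝ) : Prop :=
  Continuous f ∧ ∃ (C : ℝ) (k : ℕ), 0 ≤ C ∧ ∀ x, |f x| ≤ C * (1 + ‖x‖) ^ k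

namespace PolyBounded

variable {X Y : Type*} [NormedAddCommGroup X] [NormedAddCommGroup Y] {f g : X → ℝ}

lemma add (hf : PolyBounded f) (hg : PolyBounded g) : PolyBounded fun x => f x + g x := by
  obtain ⟨hfc, C, k, hC, hf⟩ := hf
  obtain ⟨hgc, D, l, hD, hg⟩ := hg
  refine ⟨hfc.add hgc, C + D, k + l, by positivity, fun x => ?_⟩
  have h1 : (1 : ℝ) ≤ 1 + ‖x‖ := by simp
  calc |f x + g x| ≤ |f x| + |g x| := abs_add_le _ _
    _ ≤ C * (1 + ‖x‖) ^ k + D * (1 + ‖x‖) ^ l := add_le_add (hf x) (hg x)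
    _ ≤ C * (1 + ‖x‖) ^ (k + l) + D * (1 + ‖x‖) ^ (k + l) := by
      gcongr <;> first | exact h1 | omega
    _ = _ := by ring

lemma mul (hf : PolyBounded f) (hg : PolyBounded g) : PolyBounded fun x => f x * g x := by
  obtain ⟨hfc, C, k, hC, hf⟩ := hf
  obtain ⟨hgc, D, l, hD, hg⟩ := hg
  refine ⟨hfc.mul hgc, C * D, k + l, by positivity, fun x => ?_⟩
  rw [abs_mul]
  calc |f x| * |g x| ≤ (C * (1 + ‖x‖) ^ k) * (D * (1 + ‖x‖) ^ l) := by
        gcongr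
        exacts [hf x, hg x]
    _ = _ := by ring

lemma of_bounded (hf : Continuous f) (C : ℝ) (h : ∀ x, |f x| ≤ C) : PolyBounded f :=
  ⟨hf, max C 0, 0, le_max_right _ _, fun x => by simpa using .inl (h x)⟩

lemma const (c : ℝ) : PolyBounded fun _ : X => c :=
  of_bounded continuous_const |c| fun _ => le_rfl

lemma const_mul (c : ℝ) (hf : PolyBounded f) : PolyBounded fun x => c * f x := (const c).mul hf

lemma neg (hf : PolyBounded f) : PolyBounded fun x => -f x := by
  simpa using hf.const_mul (-1)

lemma sub (hf : PolyBounded f) (hg : PolyBounded g) : PolyBounded fun x => f x - g x := by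
  simpa [sub_eq_add_neg] using hf.add hg.neg

lemma pow (hf : PolyBounded f) (n : ℕ) : PolyBounded fun x => f x ^ n := by
  induction n with
  | zero => simpa using const 1
  | succ n ih => simpa [pow_succ] using ih.mul hf

lemma sum {ι : Type*} (s : Finset ι) {f : ι → X → ℝ} (hf : ∀ i, PolyBounded (f i)) :
    PolyBounded fun x => ∑ i ∈ s, f i x := by
  classical
  induction s using Finset.induction_on with
  | empty => simpa using const 0
  | insert i s hi ih => simpa [Finset.sum_insert hi] using (hf i).add ih

lemma clm [NormedSpace ℝ X] (L : X →L[ℝ] ℝ) : PolyBounded L := by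
  refine ⟨L.continuous, ‖L‖, 1, by positivity, fun x => ?_⟩
  have := L.le_opNorm x
  rw [norm_eq_abs] at this
  nlinarith [norm_nonneg L]

lemma comp_clm [NormedSpace ℝ X] [NormedSpace ℝ Y] (hf : PolyBounded f) (L : Y →L[ℝ] X) :
    PolyBounded fun y => f (L y) := by
  obtain ⟨hfc, C, k, hC, hf⟩ := hf
  refine ⟨by fun_prop, C * (1 + ‖L‖) ^ k, k, by positivity, fun y => (hf _).trans ?_⟩
  rw [mul_assoc, ← mul_pow]
  gcongr
  nlinarith [L.le_opNorm y, norm_nonneg L, norm_nonneg y]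

lemma comp_prodMk_left {f : X × Y → ℝ} (hf : PolyBounded f) (x : X) :
    PolyBounded fun y => f (x, y) := by
  obtain ⟨hfc, C, k, hC, hf⟩ := hf
  refine ⟨by fun_prop, C * (1 + ‖x‖) ^ k, k, by positivity, fun y => (hf _).trans ?_⟩
  rw [mul_assoc, ← mul_pow]
  gcongr
  have : ‖(x, y)‖ ≤ ‖x‖ + ‖y‖ :=
    max_le (by simp) (by simp)
  nlinarith [norm_nonneg x, norm_nonneg y]

lemma comp_prodMk_right {f : X × Y → ℝ} (hf : PolyBounded f) (y : Y) :
    PolyBounded fun x => f (x, y) := by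
  obtain ⟨hfc, C, k, hC, hf⟩ := hf
  refine ⟨by fun_prop, C * (1 + ‖y‖) ^ k, k, by positivity, fun x => (hf _).trans ?_⟩
  rw [mul_assoc, ← mul_pow]
  gcongr
  have : ‖(x, y)‖ ≤ ‖x‖ + ‖y‖ :=
    max_le (by simp) (by simp)
  nlinarith [norm_nonneg x, norm_nonneg y]

variable {d : ℕ}

lemma dotProduct {f g : X → Fin d → ℝ} (hf : ∀ i, PolyBounded fun x => f x i)
    (hg : ∀ i, PolyBounded fun x => g x i) : PolyBounded fun x => f x ⬝ᵥ g x :=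
  sum _ fun i => (hf i).mul (hg i)

lemma mulVec (M : Matrix (Fin d) (Fin d) ℝ) {f : X → Fin d → ℝ}
    (hf : ∀ i, PolyBounded fun x => f x i) (i : Fin d) : PolyBounded fun x => (M *ᵥ f x) i :=
  dotProduct (fun j => const (M i j)) hf

lemma apply (i : Fin d) : PolyBounded fun z : Fin d → ℝ => z i :=
  clm (ContinuousLinearMap.proj (R := ℝ) (φ := fun _ : Fin d => ℝ) i)

variable {R : Matrix (Fin d) (Fin d) ℝ}

lemma integrable_one_add_norm_pow (hR : R.PosDef) (k : ℕ) :
    Integrable (fun z : Fin d → ℝ => (1 + ‖z‖) ^ k) (gaussN 0 R) := by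
  have := isProbabilityMeasure_gaussN 0 hR
  have h1 (i : Fin d) : MemLp (fun z : Fin d → ℝ => z i) k (gaussN 0 R) := by
    have h0 : 0 ∈ interior (integrableExpSet (fun z : Fin d → ℝ => Pi.single i 1 ⬝ᵥ z)
        (gaussN 0 R)) := by
      rw [integrableExpSet_gaussN hR]
      simp
    have h := memLp_of_mem_interior_integrableExpSet h0 k
    simp only [single_one_dotProduct, ENNReal.coe_natCast] at h
    exact h
  have h1' : MemLp (fun z : Fin d → ℝ => z) k (gaussN 0 R) := memLp_pi_iff.2 h1
  have h1n : MemLp (fun z : Fin d → ℝ => ‖z‖) k (gaussN 0 R) := h1'.norm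
  have hc : MemLp (fun _ : Fin d → ℝ => (1 : ℝ)) k (gaussN 0 R) := memLp_const 1
  have h2 : MemLp (fun z : Fin d → ℝ => 1 + ‖z‖) k (gaussN 0 R) := hc.add h1n
  have h3 := h2.integrable_norm_pow'
  refine h3.congr (.of_forall fun z => ?_)
  simp only
  rw [norm_of_nonneg (by positivity)]

lemma integrable {f : (Fin d → ℝ) → ℝ} (hf : PolyBounded f) (hR : R.PosDef) :
    Integrable f (gaussN 0 R) := by
  obtain ⟨hfc, C, k, hC, hf⟩ := hf
  exact ((integrable_one_add_norm_pow hR k).const_mul C).mono' hfc.aestronglyMeasurable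
    (.of_forall hf)

lemma integrable_prod {f : (Fin d → ℝ) × (Fin d → ℝ) → ℝ} (hf : PolyBounded f) (hR : R.PosDef) :
    Integrable f ((gaussN 0 R).prod (gaussN 0 R)) := by
  have := isProbabilityMeasure_gaussN 0 hR
  obtain ⟨hfc, C, k, hC, hf⟩ := hf
  refine (((integrable_one_add_norm_pow hR k).mul_prod
    (integrable_one_add_norm_pow hR k)).const_mul C).mono' hfc.aestronglyMeasurable
    (.of_forall fun z => (hf z).trans ?_)
  rw [← mul_pow]
  gcongr
  have : ‖z‖ ≤ ‖z.1‖ + ‖z.2‖ := max_le (by simp) (by simp)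
  nlinarith [norm_nonneg z.1, norm_nonneg z.2]

end PolyBounded

section Isserlis

variable {d : ℕ} {R : Matrix (Fin d) (Fin d) ℝ}

lemma PolyBounded.dotProduct_left (a : Fin d → ℝ) : PolyBounded fun z : Fin d → ℝ => a ⬝ᵥ z :=
  .dotProduct (fun _ => .const _) .apply

lemma integral_dotProduct_gaussN (hR : R.PosDef) (a : Fin d → ℝ) :
    ∫ z, a ⬝ᵥ z ∂(gaussN 0 R) = 0 := by
  have h := integral_gaussN_neg hR fun z => a ⬝ᵥ z
  simp only [dotProduct_neg, integral_neg] at h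
  linarith

lemma integral_dotProduct_mul_three_gaussN (hR : R.PosDef) (a b c : Fin d → ℝ) :
    ∫ z, (a ⬝ᵥ z) * ((b ⬝ᵥ z) * (c ⬝ᵥ z)) ∂(gaussN 0 R) = 0 := by
  have h := integral_gaussN_neg hR fun z => (a ⬝ᵥ z) * ((b ⬝ᵥ z) * (c ⬝ᵥ z))
  simp only [dotProduct_neg, neg_mul, mul_neg, neg_neg, integral_neg] at h
  linarith

lemma integral_dotProduct_mul_gaussN (hR : R.PosDef) (a b : Fin d → ℝ) :
    ∫ z, (a ⬝ᵥ z) * (b ⬝ᵥ z) ∂(gaussN 0 R) = a ⬝ᵥ (R *ᵥ b) := by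
  have pb (v : Fin d → ℝ) : Integrable (fun z => (v ⬝ᵥ z) ^ 2) (gaussN 0 R) :=
    ((PolyBounded.dotProduct_left v).pow 2).integrable hR
  have h : ∀ z : Fin d → ℝ, (a ⬝ᵥ z) * (b ⬝ᵥ z)
      = (1 / 4) * (((a + b) ⬝ᵥ z) ^ 2 - ((a - b) ⬝ᵥ z) ^ 2) := by
    intro z
    rw [add_dotProduct, sub_dotProduct]
    ring
  simp_rw [h]
  rw [integral_const_mul, integral_sub (pb _) (pb _), integral_dotProduct_sq_gaussN hR,
    integral_dotProduct_sq_gaussN hR]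
  simp only [mulVec_add, mulVec_sub, add_dotProduct, sub_dotProduct, dotProduct_add,
    dotProduct_sub, dotProduct_mulVec_comm_of_symm hR.transpose_eq b a]
  ring

/-- Isserlis' formula for the fourth moments of a centred Gaussian measure. -/
lemma integral_dotProduct_mul_four_gaussN (hR : R.PosDef) (a b c e : Fin d → ℝ) :
    ∫ z, (a ⬝ᵥ z) * (b ⬝ᵥ z) * ((c ⬝ᵥ z) * (e ⬝ᵥ z)) ∂(gaussN 0 R)
      = (a ⬝ᵥ (R *ᵥ b)) * (c ⬝ᵥ (R *ᵥ e)) + (a ⬝ᵥ (R *ᵥ c)) * (b ⬝ᵥ (R *ᵥ e))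
        + (a ⬝ᵥ (R *ᵥ e)) * (b ⬝ᵥ (R *ᵥ c)) := by
  have sq (a b : Fin d → ℝ) : ∫ z, (a ⬝ᵥ z) ^ 2 * (b ⬝ᵥ z) ^ 2 ∂(gaussN 0 R)
      = (a ⬝ᵥ (R *ᵥ a)) * (b ⬝ᵥ (R *ᵥ b)) + 2 * (a ⬝ᵥ (R *ᵥ b)) ^ 2 := by
    have pb (v w : Fin d → ℝ) : PolyBounded fun z => (v ⬝ᵥ z) ^ 4 + (w ⬝ᵥ z) ^ 4 :=
      ((PolyBounded.dotProduct_left v).pow 4).add ((PolyBounded.dotProduct_left w).pow 4)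
    have hadd (v w : Fin d → ℝ) : ∫ z, ((v ⬝ᵥ z) ^ 4 + (w ⬝ᵥ z) ^ 4) ∂(gaussN 0 R)
        = 3 * (v ⬝ᵥ (R *ᵥ v)) ^ 2 + 3 * (w ⬝ᵥ (R *ᵥ w)) ^ 2 := by
      rw [integral_add (((PolyBounded.dotProduct_left v).pow 4).integrable hR)
        (((PolyBounded.dotProduct_left w).pow 4).integrable hR),
        integral_dotProduct_pow_four_gaussN hR, integral_dotProduct_pow_four_gaussN hR]
    have h : ∀ z : Fin d → ℝ, (a ⬝ᵥ z) ^ 2 * (b ⬝ᵥ z) ^ 2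
        = (1 / 12) * (((a + b) ⬝ᵥ z) ^ 4 + ((a - b) ⬝ᵥ z) ^ 4
          - 2 * ((a ⬝ᵥ z) ^ 4 + (b ⬝ᵥ z) ^ 4)) := by
      intro z
      rw [add_dotProduct, sub_dotProduct]
      ring
    simp_rw [h]
    rw [integral_const_mul, integral_sub ((pb _ _).integrable hR)
      (((pb _ _).const_mul 2).integrable hR), integral_const_mul, hadd, hadd]
    simp only [mulVec_add, mulVec_sub, add_dotProduct, sub_dotProduct, dotProduct_add,
      dotProduct_sub, dotProduct_mulVec_comm_of_symm hR.transpose_eq b a]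
    ring
  have mixed (a b c : Fin d → ℝ) :
      ∫ z, (a ⬝ᵥ z) * (b ⬝ᵥ z) * (c ⬝ᵥ z) ^ 2 ∂(gaussN 0 R)
        = (a ⬝ᵥ (R *ᵥ b)) * (c ⬝ᵥ (R *ᵥ c)) + 2 * ((a ⬝ᵥ (R *ᵥ c)) * (b ⬝ᵥ (R *ᵥ c))) := by
    have pb (v w : Fin d → ℝ) : Integrable (fun z => (v ⬝ᵥ z) ^ 2 * (w ⬝ᵥ z) ^ 2) (gaussN 0 R) :=
      (((PolyBounded.dotProduct_left v).pow 2).mul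
        ((PolyBounded.dotProduct_left w).pow 2)).integrable hR
    have h : ∀ z : Fin d → ℝ, (a ⬝ᵥ z) * (b ⬝ᵥ z) * (c ⬝ᵥ z) ^ 2
        = (1 / 4) * (((a + b) ⬝ᵥ z) ^ 2 * (c ⬝ᵥ z) ^ 2
          - ((a - b) ⬝ᵥ z) ^ 2 * (c ⬝ᵥ z) ^ 2) := by
      intro z
      rw [add_dotProduct, sub_dotProduct]
      ring
    simp_rw [h]
    rw [integral_const_mul, integral_sub (pb _ _) (pb _ _), sq, sq]
    simp only [mulVec_add, mulVec_sub, add_dotProduct, sub_dotProduct, dotProduct_add,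
      dotProduct_sub, dotProduct_mulVec_comm_of_symm hR.transpose_eq b a]
    ring
  have pb (w : Fin d → ℝ) :
      Integrable (fun z => (a ⬝ᵥ z) * (b ⬝ᵥ z) * (w ⬝ᵥ z) ^ 2) (gaussN 0 R) :=
    (((PolyBounded.dotProduct_left a).mul (PolyBounded.dotProduct_left b)).mul
      ((PolyBounded.dotProduct_left w).pow 2)).integrable hR
  have h : ∀ z : Fin d → ℝ, (a ⬝ᵥ z) * (b ⬝ᵥ z) * ((c ⬝ᵥ z) * (e ⬝ᵥ z))
      = (1 / 4) * ((a ⬝ᵥ z) * (b ⬝ᵥ z) * ((c + e) ⬝ᵥ z) ^ 2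
        - (a ⬝ᵥ z) * (b ⬝ᵥ z) * ((c - e) ⬝ᵥ z) ^ 2) := by
    intro z
    rw [add_dotProduct, sub_dotProduct]
    ring
  simp_rw [h]
  rw [integral_const_mul, integral_sub (pb _) (pb _), mixed, mixed]
  simp only [mulVec_add, mulVec_sub, add_dotProduct, sub_dotProduct, dotProduct_add,
    dotProduct_sub, dotProduct_mulVec_comm_of_symm hR.transpose_eq e c]
  ring

end Isserlis

/-- The quadratic polynomial `y ↦ κ + β·y + yᵀNy`. -/
def quadPoly {d : ℕ} (κ : ℝ) (β : Fin d → ℝ) (N : Matrix (Fin d) (Fin d) ℝ) (y : Fin d → ℝ) :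
    ℝ :=
  κ + β ⬝ᵥ y + y ⬝ᵥ (N *ᵥ y)

section QuadPoly

variable {d : ℕ} {R S : Matrix (Fin d) (Fin d) ℝ}

lemma PolyBounded.quadPoly (κ : ℝ) (β : Fin d → ℝ) (N : Matrix (Fin d) (Fin d) ℝ) :
    PolyBounded (quadPoly κ β N) :=
  ((const κ).add (.dotProduct_left β)).add (.dotProduct .apply (.mulVec N .apply))

lemma integral_mul_quadForm (hR : R.PosDef) {f : (Fin d → ℝ) → ℝ} (hf : PolyBounded f)
    (N : Matrix (Fin d) (Fin d) ℝ) :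
    ∫ y, f y * (y ⬝ᵥ (N *ᵥ y)) ∂(gaussN 0 R)
      = ∑ i, ∑ j, N i j * ∫ y, f y * (((Pi.single i 1 : Fin d → ℝ) ⬝ᵥ y)
          * ((Pi.single j 1 : Fin d → ℝ) ⬝ᵥ y)) ∂(gaussN 0 R) := by
  have pb (i j : Fin d) : PolyBounded fun y : Fin d → ℝ => N i j * (f y * (y i * y j)) :=
    .const_mul _ (hf.mul ((PolyBounded.apply i).mul (PolyBounded.apply j)))
  have h : ∀ y, f y * (y ⬝ᵥ (N *ᵥ y)) = ∑ i, ∑ j, N i j * (f y * (y i * y j)) := by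
    intro y
    simp only [dotProduct, mulVec, Finset.mul_sum]
    refine Finset.sum_congr rfl fun i _ => Finset.sum_congr rfl fun j _ => by ring
  simp_rw [h, single_one_dotProduct]
  rw [integral_finsetSum _ fun i _ => (PolyBounded.sum _ (pb i)).integrable hR]
  refine Finset.sum_congr rfl fun i _ => ?_
  rw [integral_finsetSum _ fun j _ => (pb i j).integrable hR]
  simp_rw [integral_const_mul]

lemma integral_mul_quadPoly (hR : R.PosDef) {f : (Fin d → ℝ) → ℝ} (hf : PolyBounded f)
    (κ : ℝ) (β : Fin d → ℝ) (N : Matrix (Fin d) (Fin d) ℝ) :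
    ∫ y, f y * quadPoly κ β N y ∂(gaussN 0 R)
      = κ * ∫ y, f y ∂(gaussN 0 R) + ∫ y, f y * (β ⬝ᵥ y) ∂(gaussN 0 R)
        + ∫ y, f y * (y ⬝ᵥ (N *ᵥ y)) ∂(gaussN 0 R) := by
  have h : ∀ y, f y * quadPoly κ β N y
      = κ * f y + f y * (β ⬝ᵥ y) + f y * (y ⬝ᵥ (N *ᵥ y)) := by
    intro y
    rw [quadPoly]
    ring
  have p1 := hf.const_mul κ
  have p2 := hf.mul (.dotProduct_left β)
  have p3 : PolyBounded fun y => f y * (y ⬝ᵥ (N *ᵥ y)) :=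
    hf.mul (.dotProduct .apply (.mulVec N .apply))
  simp_rw [h]
  rw [integral_add ((p1.add p2).integrable hR) (p3.integrable hR),
    integral_add (p1.integrable hR) (p2.integrable hR), integral_const_mul]

/-- A function is orthogonal to all quadratic polynomials as soon as it is orthogonal to the
constants, the linear forms and the products of two linear forms. -/
lemma integral_mul_quadPoly_congr (hR : R.PosDef) {f g : (Fin d → ℝ) → ℝ} (hf : PolyBounded f)
    (hg : PolyBounded g) (h0 : ∫ y, f y ∂(gaussN 0 R) = ∫ y, g y ∂(gaussN 0 R))
    (h1 : ∀ a : Fin d → ℝ,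
      ∫ y, f y * (a ⬝ᵥ y) ∂(gaussN 0 R) = ∫ y, g y * (a ⬝ᵥ y) ∂(gaussN 0 R))
    (h2 : ∀ a b : Fin d → ℝ, ∫ y, f y * ((a ⬝ᵥ y) * (b ⬝ᵥ y)) ∂(gaussN 0 R)
      = ∫ y, g y * ((a ⬝ᵥ y) * (b ⬝ᵥ y)) ∂(gaussN 0 R))
    (κ : ℝ) (β : Fin d → ℝ) (N : Matrix (Fin d) (Fin d) ℝ) :
    ∫ y, f y * quadPoly κ β N y ∂(gaussN 0 R) = ∫ y, g y * quadPoly κ β N y ∂(gaussN 0 R) := by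
  rw [integral_mul_quadPoly hR hf, integral_mul_quadPoly hR hg, h0, h1,
    integral_mul_quadForm hR hf, integral_mul_quadForm hR hg]
  simp_rw [h2]

variable (κ : ℝ) (β : Fin d → ℝ) {M : Matrix (Fin d) (Fin d) ℝ}

lemma trace_mul_eq_sum (hR : R.PosDef) (M : Matrix (Fin d) (Fin d) ℝ) :
    (M * R).trace = ∑ i, ∑ j, M i j * R i j := by
  conv_lhs => rw [← hR.transpose_eq]
  simp [trace, mul_apply]

lemma integral_quadPoly (hR : R.PosDef) :
    ∫ y, quadPoly κ β M y ∂(gaussN 0 R) = κ + (M * R).trace := by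
  have := isProbabilityMeasure_gaussN 0 hR
  have h := integral_mul_quadPoly hR (.const 1) κ β M
  rw [integral_mul_quadForm hR (.const 1)] at h
  simp only [one_mul, integral_dotProduct_mul_gaussN hR, integral_dotProduct_gaussN hR] at h
  rw [h, trace_mul_eq_sum hR]
  simp

lemma integral_quadPoly_mul_dotProduct (hR : R.PosDef) (a : Fin d → ℝ) :
    ∫ y, quadPoly κ β M y * (a ⬝ᵥ y) ∂(gaussN 0 R) = β ⬝ᵥ (R *ᵥ a) := by
  have h := integral_mul_quadPoly hR (.dotProduct_left a) κ β M
  rw [integral_mul_quadForm hR (.dotProduct_left a)] at h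
  simp only [integral_dotProduct_mul_gaussN hR, integral_dotProduct_gaussN hR,
    integral_dotProduct_mul_three_gaussN hR] at h
  simp_rw [mul_comm _ (a ⬝ᵥ _)]
  rw [h, dotProduct_mulVec_comm_of_symm hR.transpose_eq]
  simp

lemma integral_quadPoly_mul_dotProduct_mul (hR : R.PosDef) (hM : Mᵀ = M) (a b : Fin d → ℝ) :
    ∫ y, quadPoly κ β M y * ((a ⬝ᵥ y) * (b ⬝ᵥ y)) ∂(gaussN 0 R)
      = (κ + (M * R).trace) * (a ⬝ᵥ (R *ᵥ b)) + 2 * ((R *ᵥ a) ⬝ᵥ (M *ᵥ (R *ᵥ b))) := by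
  have hf := (PolyBounded.dotProduct_left a).mul (.dotProduct_left b)
  have h := integral_mul_quadPoly hR hf κ β M
  rw [integral_mul_quadForm hR hf] at h
  have h3 : ∫ y, (a ⬝ᵥ y) * (b ⬝ᵥ y) * (β ⬝ᵥ y) ∂(gaussN 0 R) = 0 := by
    simp_rw [mul_assoc]
    exact integral_dotProduct_mul_three_gaussN hR a b β
  have e (v : Fin d → ℝ) (i : Fin d) : v ⬝ᵥ (R *ᵥ Pi.single i 1) = (R *ᵥ v) i := by
    rw [dotProduct_mulVec_comm_of_symm hR.transpose_eq, single_one_dotProduct]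
  have e0 (i j : Fin d) : (Pi.single i 1 : Fin d → ℝ) ⬝ᵥ (R *ᵥ Pi.single j 1) = R i j := by
    rw [single_one_dotProduct, mulVec_single_one, col_apply]
  have hsum : ∑ i, ∑ j, M i j * ((R *ᵥ a) i * (R *ᵥ b) j) = (R *ᵥ a) ⬝ᵥ (M *ᵥ (R *ᵥ b)) := by
    simp only [dotProduct, mulVec, Finset.mul_sum]
    refine Finset.sum_congr rfl fun i _ => Finset.sum_congr rfl fun j _ => ?_
    refine Finset.sum_congr rfl fun k _ => by ring
  have hsum' : ∑ i, ∑ j, M i j * ((R *ᵥ a) j * (R *ᵥ b) i) = (R *ᵥ a) ⬝ᵥ (M *ᵥ (R *ᵥ b)) := by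
    rw [Finset.sum_comm, ← hsum]
    conv_rhs => rw [← hM]
    rfl
  simp_rw [mul_comm _ ((a ⬝ᵥ _) * _)]
  rw [h, integral_dotProduct_mul_gaussN hR, h3]
  simp only [integral_dotProduct_mul_four_gaussN hR]
  simp only [e0, e, mul_add, Finset.sum_add_distrib, hsum, hsum']
  rw [trace_mul_eq_sum hR, add_mul, Finset.sum_mul]
  simp only [Finset.sum_mul]
  have : ∑ i, ∑ j, M i j * (a ⬝ᵥ (R *ᵥ b) * R i j)
      = ∑ i, ∑ j, M i j * R i j * (a ⬝ᵥ (R *ᵥ b)) :=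
    Finset.sum_congr rfl fun i _ => Finset.sum_congr rfl fun j _ => by ring
  rw [this]
  ring

end QuadPoly

section Tilt

variable {d : ℕ} {R S N : Matrix (Fin d) (Fin d) ℝ}

/-- Multiplying a centred Gaussian measure by the exponential of a quadratic polynomial gives a
multiple of another Gaussian measure. -/
lemma integral_exp_mul_gaussN (hS : S.PosDef) (hR : R.PosDef) {σ D : ℝ} (hD : 0 < D)
    (hinv : R⁻¹ = S⁻¹ + (2 * σ) • N) (hdet : S.det = R.det * D) (w : Fin d → ℝ)
    (f : (Fin d → ℝ) → ℝ) :
    ∫ z, exp (-σ * (z ⬝ᵥ (N *ᵥ z)) + w ⬝ᵥ z) * f z ∂(gaussN 0 S)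
      = D ^ (-(1 : ℝ) / 2) * exp (w ⬝ᵥ (R *ᵥ w) / 2) * ∫ z, f (z + R *ᵥ w) ∂(gaussN 0 R) := by
  rw [← integral_gaussN_translate _ hR]
  refine integral_gaussN_tilt hS hR (fun z => ?_) f
  have hq := quadForm_sub_mulVec hR z w
  rw [gaussDensity, gaussDensity, hq, hdet, mul_rpow hR.det_pos.le hD.le, sub_zero, hinv,
    add_mulVec, smul_mulVec, dotProduct_add, dotProduct_smul, smul_eq_mul]
  have h : exp (-(z ⬝ᵥ (S⁻¹ *ᵥ z)) / 2) * exp (-σ * (z ⬝ᵥ (N *ᵥ z)) + w ⬝ᵥ z)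
      = exp (w ⬝ᵥ (R *ᵥ w) / 2) * exp (-(z ⬝ᵥ (S⁻¹ *ᵥ z) + 2 * σ * (z ⬝ᵥ (N *ᵥ z))
        - 2 * (w ⬝ᵥ z) + w ⬝ᵥ (R *ᵥ w)) / 2) := by
    rw [← exp_add, ← exp_add]
    congr 1
    ring
  linear_combination ((2 * π) ^ (-(d : ℝ) / 2) * (R.det ^ (-(1 : ℝ) / 2) * D ^ (-(1 : ℝ) / 2))) * h

end Tilt

section VW

variable {d : ℕ} {S : Matrix (Fin d) (Fin d) ℝ} {σ : ℝ}

lemma posDef_Vm (hσ : 0 < σ) (hS : S.PosDef) : (Vm σ S).PosDef :=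
  PosDef.one.add (hS.smul (by positivity : 0 < 2 * σ))

lemma two_smul_Vm_sub_one : (2 : ℝ) • Vm σ S - 1 = Vm (2 * σ) S := by
  rw [Vm, Vm, smul_add, smul_smul, two_smul]
  module

lemma Vm_mul_self_comm : Vm σ S * S = S * Vm σ S := by
  simp [Vm, add_mul, mul_add]

lemma inv_Vm_mul_comm (hσ : 0 < σ) (hS : S.PosDef) : (Vm σ S)⁻¹ * S = S * (Vm σ S)⁻¹ := by
  have hV := posDef_Vm hσ hS
  calc (Vm σ S)⁻¹ * S = (Vm σ S)⁻¹ * (S * Vm σ S) * (Vm σ S)⁻¹ := by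
        rw [mul_assoc, mul_assoc, hV.mul_inv_self, mul_one]
    _ = _ := by rw [← Vm_mul_self_comm, ← mul_assoc, hV.inv_mul_self, one_mul]

lemma inv_Vm_eq (hσ : 0 < σ) (hS : S.PosDef) :
    (Vm σ S)⁻¹ = 1 - (2 * σ) • (S * (Vm σ S)⁻¹) := by
  have h := (posDef_Vm hσ hS).mul_inv_self
  nth_rw 1 [Vm] at h
  rw [add_mul, one_mul, smul_mul] at h
  exact eq_sub_of_add_eq h

lemma mul_inv_Vm_eq (hσ : 0 < σ) (hS : S.PosDef) :
    S * (Vm σ S)⁻¹ = S - (2 * σ) • (S * (Vm σ S)⁻¹ * S) := by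
  conv_lhs => rw [← inv_Vm_mul_comm hσ hS, inv_Vm_eq hσ hS]
  rw [sub_mul, one_mul, smul_mul]

/-- `S V⁻¹` is the covariance obtained by tilting `N(0, S)` by `exp (-σ ‖z‖²)`. -/
lemma inv_mul_inv_Vm (hσ : 0 < σ) (hS : S.PosDef) :
    (S * (Vm σ S)⁻¹)⁻¹ = S⁻¹ + (2 * σ) • (1 : Matrix (Fin d) (Fin d) ℝ) := by
  rw [Matrix.mul_inv_rev, nonsing_inv_nonsing_inv _ (posDef_Vm hσ hS).det_pos.ne'.isUnit, Vm,
    add_mul, smul_mul, hS.mul_inv_self, one_mul]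

lemma posDef_mul_inv_Vm (hσ : 0 < σ) (hS : S.PosDef) : (S * (Vm σ S)⁻¹).PosDef := by
  refine posDef_inv_iff.1 ?_
  rw [inv_mul_inv_Vm hσ hS]
  exact hS.inv.add (PosDef.one.smul (by positivity))

lemma Vm_mul_inv_Vm_two_mul (hσ : 0 < σ) (hS : S.PosDef) :
    Vm σ S * (Vm (2 * σ) S)⁻¹ = 1 - (2 * σ) • (S * (Vm (2 * σ) S)⁻¹) := by
  have h : Vm σ S = Vm (2 * σ) S - (2 * σ) • S := by
    rw [Vm, Vm]
    module
  rw [h, sub_mul, (posDef_Vm (by positivity) hS).mul_inv_self, smul_mul]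

lemma inv_Vm_two_mul_mul_Vm (hσ : 0 < σ) (hS : S.PosDef) :
    (Vm (2 * σ) S)⁻¹ * Vm σ S = Vm σ S * (Vm (2 * σ) S)⁻¹ := by
  have h := inv_Vm_mul_comm (by positivity : 0 < 2 * σ) hS
  rw [Vm.eq_1 σ, mul_add, add_mul, Matrix.mul_smul, smul_mul, h, mul_one, one_mul]

/-- The covariance obtained by tilting `N(0, S)` by `exp (-σ zᵀ V⁻¹ z)`. -/
noncomputable def tiltCov (σ : ℝ) (S : Matrix (Fin d) (Fin d) ℝ) : Matrix (Fin d) (Fin d) ℝ :=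
  S * (Vm σ S * (Vm (2 * σ) S)⁻¹)

lemma inv_Vm_mul_tiltCov (hσ : 0 < σ) (hS : S.PosDef) :
    (Vm σ S)⁻¹ * tiltCov σ S = (Vm (2 * σ) S)⁻¹ * S := by
  rw [tiltCov, ← mul_assoc, inv_Vm_mul_comm hσ hS, mul_assoc, ← mul_assoc (Vm σ S)⁻¹,
    (posDef_Vm hσ hS).inv_mul_self, one_mul, inv_Vm_mul_comm (by positivity) hS]

lemma tiltCov_eq (hσ : 0 < σ) (hS : S.PosDef) :
    tiltCov σ S = S - (2 * σ) • (S * (Vm (2 * σ) S)⁻¹ * S) := by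
  rw [tiltCov, Vm_mul_inv_Vm_two_mul hσ hS, mul_sub, mul_one, Matrix.mul_smul, mul_assoc S _ S,
    inv_Vm_mul_comm (by positivity) hS]

lemma inv_tiltCov (hσ : 0 < σ) (hS : S.PosDef) :
    (tiltCov σ S)⁻¹ = S⁻¹ + (2 * σ) • (Vm σ S)⁻¹ := by
  have h : Vm (2 * σ) S = Vm σ S + (2 * σ) • S := by
    rw [Vm, Vm]
    module
  rw [tiltCov, Matrix.mul_inv_rev, Matrix.mul_inv_rev,
    nonsing_inv_nonsing_inv _ (posDef_Vm (by positivity) hS).det_pos.ne'.isUnit, h, add_mul,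
    (posDef_Vm hσ hS).mul_inv_self, smul_mul, ← inv_Vm_mul_comm hσ hS, add_mul, one_mul, smul_mul,
    mul_assoc, hS.mul_inv_self, mul_one]

lemma posDef_tiltCov (hσ : 0 < σ) (hS : S.PosDef) : (tiltCov σ S).PosDef := by
  refine posDef_inv_iff.1 ?_
  rw [inv_tiltCov hσ hS]
  exact hS.inv.add ((posDef_Vm hσ hS).inv.smul (by positivity))

lemma det_mul_inv_Vm (hσ : 0 < σ) (hS : S.PosDef) :
    S.det = (S * (Vm σ S)⁻¹).det * (Vm σ S).det := by
  rw [← det_mul, mul_assoc, (posDef_Vm hσ hS).inv_mul_self, mul_one]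

lemma det_tiltCov (hσ : 0 < σ) (hS : S.PosDef) :
    S.det = (tiltCov σ S).det * ((Vm (2 * σ) S).det / (Vm σ S).det) := by
  have hV := (posDef_Vm hσ hS).det_pos.ne'
  have hW := (posDef_Vm (by positivity : 0 < 2 * σ) hS).det_pos.ne'
  rw [tiltCov, det_mul, det_mul, det_nonsing_inv, Ring.inverse_eq_inv']
  field_simp

lemma inv_Vm_two_mul_eq (hσ : 0 < σ) (hS : S.PosDef) :
    (Vm (2 * σ) S)⁻¹ = (Vm σ S)⁻¹ - (2 * σ) • ((Vm (2 * σ) S)⁻¹ * S * (Vm σ S)⁻¹) := by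
  have h := Vm_mul_inv_Vm_two_mul hσ hS
  rw [← inv_Vm_two_mul_mul_Vm hσ hS, ← inv_Vm_mul_comm (by positivity) hS] at h
  calc (Vm (2 * σ) S)⁻¹ = (Vm (2 * σ) S)⁻¹ * Vm σ S * (Vm σ S)⁻¹ := by
        rw [mul_assoc, (posDef_Vm hσ hS).mul_inv_self, mul_one]
    _ = _ := by rw [h, sub_mul, one_mul, smul_mul]

end VW

namespace PolyBounded

variable {X : Type*} [NormedAddCommGroup X] {d : ℕ} {F G : X → Matrix (Fin d) (Fin d) ℝ}

lemma matrix_mul (hF : ∀ i j, PolyBounded fun x => F x i j)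
    (hG : ∀ i j, PolyBounded fun x => G x i j) (i j : Fin d) :
    PolyBounded fun x => (F x * G x) i j := by
  simp_rw [mul_apply]
  exact sum _ fun k => (hF i k).mul (hG k j)

lemma matrix_trace (hF : ∀ i j, PolyBounded fun x => F x i j) :
    PolyBounded fun x => (F x).trace :=
  sum _ fun i => hF i i

lemma vecMulVec {f g : X → Fin d → ℝ} (hf : ∀ i, PolyBounded fun x => f x i)
    (hg : ∀ i, PolyBounded fun x => g x i) (i j : Fin d) :
    PolyBounded fun x => vecMulVec (f x) (g x) i j :=
  (hf i).mul (hg j)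

end PolyBounded

section Kernels

variable {d : ℕ} {S : Matrix (Fin d) (Fin d) ℝ} {σ : ℝ}

lemma exp_quadForm_le_one {N : Matrix (Fin d) (Fin d) ℝ} (hσ : 0 < σ) (hN : N.PosSemidef)
    (x : Fin d → ℝ) : exp (-σ * (x ⬝ᵥ (N *ᵥ x))) ≤ 1 := by
  have h := hN.dotProduct_mulVec_nonneg x
  rw [star_trivial] at h
  rw [exp_le_one_iff]
  nlinarith

lemma polyBounded_fst (i : Fin d) :
    PolyBounded fun p : (Fin d → ℝ) × (Fin d → ℝ) => p.1 i :=
  .comp_clm (f := fun z : Fin d → ℝ => z i) (.apply i) (.fst ℝ _ (Fin d → ℝ))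

lemma polyBounded_snd (i : Fin d) :
    PolyBounded fun p : (Fin d → ℝ) × (Fin d → ℝ) => p.2 i :=
  .comp_clm (f := fun z : Fin d → ℝ => z i) (.apply i) (.snd ℝ (Fin d → ℝ) _)

lemma polyBounded_Bm {X : Type*} [NormedAddCommGroup X] {f : X → Fin d → ℝ}
    (hf : ∀ i, PolyBounded fun x => f x i) (i j : Fin d) :
    PolyBounded fun x => Bm 0 S (f x) i j := by
  simp only [Bm, sub_zero]
  exact (PolyBounded.vecMulVec hf hf i j).sub (.const _)

lemma polyBounded_T1 (hσ : 0 < σ) :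
    PolyBounded fun p : (Fin d → ℝ) × (Fin d → ℝ) => T1 σ p.1 p.2 := by
  refine .of_bounded ?_ 1 fun p => ?_
  · unfold T1
    simp only [dotProduct, Pi.sub_apply]
    fun_prop
  · rw [T1, abs_exp]
    simpa using exp_quadForm_le_one hσ PosSemidef.one (p.1 - p.2)

lemma polyBounded_T2 (hσ : 0 < σ) (hS : S.PosDef) :
    PolyBounded fun p : (Fin d → ℝ) × (Fin d → ℝ) => T2 σ 0 S p.1 p.2 := by
  have he : PolyBounded fun p : (Fin d → ℝ) × (Fin d → ℝ) =>
      exp (-σ * (p.1 ⬝ᵥ ((Vm σ S)⁻¹ *ᵥ p.1))) := by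
    refine .of_bounded ?_ 1 fun p => ?_
    · simp only [dotProduct, mulVec]
      fun_prop
    · rw [abs_exp]
      exact exp_quadForm_le_one hσ (posDef_Vm hσ hS).inv.posSemidef p.1
  simp only [T2, sub_zero]
  have hU (i j : Fin d) : PolyBounded fun _ : (Fin d → ℝ) × (Fin d → ℝ) => (Vm σ S)⁻¹ i j :=
    .const _
  have hx (i j : Fin d) : PolyBounded fun p : (Fin d → ℝ) × (Fin d → ℝ) =>
      ((2 * σ) • (Bm 0 S p.1 + S)) i j :=
    .const_mul _ (.add (polyBounded_Bm polyBounded_fst i j) (.const _))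
  have hx' (i j : Fin d) : PolyBounded fun p : (Fin d → ℝ) × (Fin d → ℝ) =>
      ((2 * σ) • (Bm 0 S p.1 + S) * (Vm σ S)⁻¹ - 1) i j :=
    .sub (.matrix_mul hx hU i j) (.const _)
  exact (he.const_mul _).mul (.add (.add (.const _) (.const_mul _ (.dotProduct polyBounded_fst
    (.mulVec _ polyBounded_snd)))) (.const_mul _ (.matrix_trace (.matrix_mul (.matrix_mul hU hx')
    (polyBounded_Bm polyBounded_snd)))))

lemma polyBounded_T4 :
    PolyBounded fun p : (Fin d → ℝ) × (Fin d → ℝ) => T4 σ 0 S p.1 p.2 := by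
  have hx (i j : Fin d) := polyBounded_Bm (S := S) polyBounded_fst i j
  have hy (i j : Fin d) := polyBounded_Bm (S := S) polyBounded_snd i j
  have hQ (i j : Fin d) : PolyBounded fun _ : (Fin d → ℝ) × (Fin d → ℝ) =>
    ((2 : ℝ) • Vm σ S - 1)⁻¹ i j := .const _
  simp only [T4, sub_zero]
  exact .const_mul _ (.add (.add (.const _) (.const_mul _ (.matrix_trace (.matrix_mul
    (fun i j => .sub (.sub (.const_mul _ (.vecMulVec polyBounded_fst polyBounded_snd i j))
      (hx i j)) (hy i j)) hQ))))
    (.const_mul _ (.add (.mul (.matrix_trace (.matrix_mul hx hQ)) (.matrix_trace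
      (.matrix_mul hy hQ))) (.const_mul _ (.matrix_trace
      (.matrix_mul (.matrix_mul (.matrix_mul hx hQ) hy) hQ))))))

lemma trace_mul_vecMulVec (N : Matrix (Fin d) (Fin d) ℝ) (a b : Fin d → ℝ) :
    (N * vecMulVec a b).trace = b ⬝ᵥ (N *ᵥ a) := by
  rw [mul_vecMulVec, trace_vecMulVec, dotProduct_comm]

lemma T1_comm (x y : Fin d → ℝ) : T1 σ x y = T1 σ y x := by
  rw [T1, T1, ← neg_sub x y, neg_dotProduct_neg]

lemma T4_comm (hσ : 0 < σ) (hS : S.PosDef) (x y : Fin d → ℝ) : T4 σ 0 S x y = T4 σ 0 S y x := by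
  have hQ := (posDef_Vm (by positivity : 0 < 2 * σ) hS).inv.transpose_eq
  simp only [T4, two_smul_Vm_sub_one, sub_zero]
  set Q := (Vm (2 * σ) S)⁻¹
  have h1 : (vecMulVec x y * Q).trace = (vecMulVec y x * Q).trace := by
    rw [trace_mul_comm, trace_mul_vecMulVec, trace_mul_comm, trace_mul_vecMulVec,
      dotProduct_mulVec_comm_of_symm hQ]
  have h2 : (Bm 0 S x * Q * Bm 0 S y * Q).trace = (Bm 0 S y * Q * Bm 0 S x * Q).trace := by
    rw [mul_assoc (_ * Q), trace_mul_comm, ← mul_assoc]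
  simp only [sub_mul, smul_mul, trace_sub, trace_smul, h1, h2]
  ring

/-- `T2` as a quadratic polynomial in its second variable. -/
lemma T2_eq_quadPoly_right (hσ : 0 < σ) (hS : S.PosDef) (x y : Fin d → ℝ) :
    T2 σ 0 S x y = (Vm σ S).det ^ (-(1 : ℝ) / 2) * exp (-σ * (x ⬝ᵥ ((Vm σ S)⁻¹ *ᵥ x))) *
      quadPoly (1 - (((2 * σ ^ 2) • vecMulVec ((Vm σ S)⁻¹ *ᵥ x) ((Vm σ S)⁻¹ *ᵥ x)
          - σ • (Vm σ S)⁻¹) * S).trace)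
        ((2 * σ) • ((Vm σ S)⁻¹ *ᵥ x))
        ((2 * σ ^ 2) • vecMulVec ((Vm σ S)⁻¹ *ᵥ x) ((Vm σ S)⁻¹ *ᵥ x) - σ • (Vm σ S)⁻¹) y := by
  have hU := (posDef_Vm hσ hS).inv.transpose_eq
  simp only [T2, Bm, sub_zero, sub_add_cancel]
  set U := (Vm σ S)⁻¹
  have hM : (2 * σ ^ 2) • vecMulVec (U *ᵥ x) (U *ᵥ x) - σ • U
      = σ • (U * ((2 * σ) • vecMulVec x x * U - 1)) := by
    rw [mul_sub, smul_mul, Matrix.mul_smul, mul_one, smul_sub, smul_smul, vecMulVec_mul,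
      mul_vecMulVec, ← mulVec_transpose, hU]
    congr 2
    ring
  rw [hM]
  simp only [quadPoly, mul_sub (U * _), trace_sub, trace_mul_vecMulVec, smul_mul, trace_smul,
    smul_mulVec, dotProduct_smul, smul_dotProduct, smul_eq_mul,
    dotProduct_mulVec_comm_of_symm hU x y, dotProduct_comm (U *ᵥ x) y]
  ring

/-- `T2` as a quadratic polynomial in its first variable, up to a Gaussian factor. -/
lemma T2_eq_quadPoly_left (x y : Fin d → ℝ) :
    T2 σ 0 S x y = (Vm σ S).det ^ (-(1 : ℝ) / 2) * exp (-σ * (x ⬝ᵥ ((Vm σ S)⁻¹ *ᵥ x))) *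
      quadPoly (1 - σ * ((Vm σ S)⁻¹ * Bm 0 S y).trace) ((2 * σ) • ((Vm σ S)⁻¹ *ᵥ y))
        ((2 * σ ^ 2) • ((Vm σ S)⁻¹ * Bm 0 S y * (Vm σ S)⁻¹)) x := by
  have hx : Bm 0 S x + S = vecMulVec x x := by simp [Bm]
  simp only [T2, sub_zero, hx]
  set U := (Vm σ S)⁻¹
  set B := Bm 0 S y
  have h : (U * (vecMulVec x x * U) * B).trace = x ⬝ᵥ ((U * B * U) *ᵥ x) := by
    rw [trace_mul_comm, ← mul_assoc, ← mul_assoc, trace_mul_comm, ← mul_assoc,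
      trace_mul_vecMulVec, ← mul_assoc]
  simp only [quadPoly, mul_sub, sub_mul, mul_one, smul_mul, Matrix.mul_smul, trace_sub, trace_smul,
    smul_mulVec, dotProduct_smul, smul_dotProduct, smul_eq_mul, h, dotProduct_comm (U *ᵥ y) x]
  ring

/-- `T4` as a quadratic polynomial in its first variable. -/
lemma T4_eq_quadPoly (hσ : 0 < σ) (hS : S.PosDef) (x y : Fin d → ℝ) :
    T4 σ 0 S x y = (Vm (2 * σ) S).det ^ (-(1 : ℝ) / 2) *
      quadPoly (1 - σ * (Bm 0 S y * (Vm (2 * σ) S)⁻¹).trace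
          - (((-σ + σ ^ 2 * (Bm 0 S y * (Vm (2 * σ) S)⁻¹).trace) • (Vm (2 * σ) S)⁻¹
            + (2 * σ ^ 2) • ((Vm (2 * σ) S)⁻¹ * Bm 0 S y * (Vm (2 * σ) S)⁻¹)) * S).trace)
        ((2 * σ) • ((Vm (2 * σ) S)⁻¹ *ᵥ y))
        ((-σ + σ ^ 2 * (Bm 0 S y * (Vm (2 * σ) S)⁻¹).trace) • (Vm (2 * σ) S)⁻¹
          + (2 * σ ^ 2) • ((Vm (2 * σ) S)⁻¹ * Bm 0 S y * (Vm (2 * σ) S)⁻¹)) x := by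
  have hQ := (posDef_Vm (by positivity : 0 < 2 * σ) hS).inv.transpose_eq
  simp only [T4, two_smul_Vm_sub_one, sub_zero]
  set Q := (Vm (2 * σ) S)⁻¹
  set B := Bm 0 S y
  have h1 : (vecMulVec x y * Q).trace = x ⬝ᵥ (Q *ᵥ y) := by
    rw [trace_mul_comm, trace_mul_vecMulVec, dotProduct_mulVec_comm_of_symm hQ]
  have h2 (N : Matrix (Fin d) (Fin d) ℝ) :
      (Bm 0 S x * N).trace = x ⬝ᵥ (N *ᵥ x) - (N * S).trace := by
    rw [trace_mul_comm, Bm, mul_sub, trace_sub, sub_zero, trace_mul_vecMulVec]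
  have h3 : Bm 0 S x * Q * B * Q = Bm 0 S x * (Q * B * Q) := by simp only [mul_assoc]
  simp only [quadPoly, sub_mul, add_mul, smul_mul, trace_add, trace_sub, trace_smul, add_mulVec,
    smul_mulVec, dotProduct_add, dotProduct_smul, smul_dotProduct, smul_eq_mul, h1, h2, h3,
    dotProduct_comm (Q *ᵥ y) x]
  ring

end Kernels

section Projection

variable {d : ℕ} {S : Matrix (Fin d) (Fin d) ℝ} {σ : ℝ}

/-- `T2 x` is the orthogonal projection of `T1 x` onto the quadratic polynomials. -/
lemma integral_T1_mul_quadPoly (hσ : 0 < σ) (hS : S.PosDef) (x : Fin d → ℝ) (κ : ℝ)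
    (β : Fin d → ℝ) (N : Matrix (Fin d) (Fin d) ℝ) :
    ∫ y, T1 σ x y * quadPoly κ β N y ∂(gaussN 0 S)
      = ∫ y, T2 σ 0 S x y * quadPoly κ β N y ∂(gaussN 0 S) := by
  have hR := posDef_mul_inv_Vm hσ hS
  have hU := (posDef_Vm hσ hS).inv.transpose_eq
  have := isProbabilityMeasure_gaussN 0 hS
  have := isProbabilityMeasure_gaussN 0 hR
  have key (f : (Fin d → ℝ) → ℝ) : ∫ y, T1 σ x y * f y ∂(gaussN 0 S)
      = (Vm σ S).det ^ (-(1 : ℝ) / 2) * exp (-σ * (x ⬝ᵥ ((Vm σ S)⁻¹ *ᵥ x))) *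
        ∫ y, f (y + (2 * σ) • (S *ᵥ ((Vm σ S)⁻¹ *ᵥ x))) ∂(gaussN 0 (S * (Vm σ S)⁻¹)) := by
    have h := integral_exp_mul_gaussN hS hR (posDef_Vm hσ hS).det_pos (inv_mul_inv_Vm hσ hS)
      (det_mul_inv_Vm hσ hS) ((2 * σ) • x) f
    have h1 (y : Fin d → ℝ) : T1 σ x y * f y = exp (-σ * (x ⬝ᵥ x)) *
        (exp (-σ * (y ⬝ᵥ ((1 : Matrix (Fin d) (Fin d) ℝ) *ᵥ y)) + ((2 * σ) • x) ⬝ᵥ y) * f y) := by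
      rw [T1, ← mul_assoc, ← exp_add, one_mulVec, smul_dotProduct, smul_eq_mul, sub_dotProduct,
        dotProduct_sub, dotProduct_sub, dotProduct_comm y x]
      ring_nf
    have h2 : -σ * (x ⬝ᵥ ((Vm σ S)⁻¹ *ᵥ x)) = -σ * (x ⬝ᵥ x)
        + ((2 * σ) • x) ⬝ᵥ ((S * (Vm σ S)⁻¹) *ᵥ ((2 * σ) • x)) / 2 := by
      conv_lhs => rw [inv_Vm_eq hσ hS]
      simp only [sub_mulVec, one_mulVec, smul_mulVec, dotProduct_sub, dotProduct_smul,
        smul_dotProduct, mulVec_smul, smul_eq_mul]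
      ring
    simp_rw [h1]
    rw [integral_const_mul, h, h2, exp_add, mulVec_smul, mulVec_mulVec]
    ring
  have hquad (y : Fin d → ℝ) := T2_eq_quadPoly_right hσ hS x y
  have hM : ((2 * σ ^ 2) • vecMulVec ((Vm σ S)⁻¹ *ᵥ x) ((Vm σ S)⁻¹ *ᵥ x) - σ • (Vm σ S)⁻¹)ᵀ
      = (2 * σ ^ 2) • vecMulVec ((Vm σ S)⁻¹ *ᵥ x) ((Vm σ S)⁻¹ *ᵥ x) - σ • (Vm σ S)⁻¹ := by
    rw [transpose_sub, transpose_smul, transpose_smul, transpose_vecMulVec, hU]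
  refine integral_mul_quadPoly_congr hS ((polyBounded_T1 hσ).comp_prodMk_left x)
    ((polyBounded_T2 hσ hS).comp_prodMk_left x) ?_ (fun a => ?_) (fun a b => ?_) κ β N
  · have h := key fun _ => 1
    simp only [mul_one, integral_const, probReal_univ, smul_eq_mul] at h
    simp_rw [h, hquad]
    rw [integral_const_mul, integral_quadPoly _ _ hS]
    ring
  · rw [key]
    simp_rw [hquad, mul_assoc _ (quadPoly _ _ _ _)]
    rw [integral_const_mul, integral_quadPoly_mul_dotProduct _ _ hS]
    simp_rw [dotProduct_add]
    rw [integral_add ((PolyBounded.dotProduct_left a).integrable hR) (integrable_const _),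
      integral_dotProduct_gaussN hR, integral_const, probReal_univ, one_smul, zero_add,
      dotProduct_smul, smul_dotProduct, dotProduct_mulVec_comm_of_symm hS.transpose_eq]
  · rw [key]
    simp_rw [hquad, mul_assoc _ (quadPoly _ _ _ _)]
    rw [integral_const_mul, integral_quadPoly_mul_dotProduct_mul _ _ hS hM]
    set c := (2 * σ) • (S *ᵥ ((Vm σ S)⁻¹ *ᵥ x)) with hc
    have h (z : Fin d → ℝ) : (a ⬝ᵥ (z + c)) * (b ⬝ᵥ (z + c)) = (a ⬝ᵥ z) * (b ⬝ᵥ z)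
        + ((a ⬝ᵥ c) • b + (b ⬝ᵥ c) • a) ⬝ᵥ z + (a ⬝ᵥ c) * (b ⬝ᵥ c) := by
      simp only [dotProduct_add, add_dotProduct, smul_dotProduct, smul_eq_mul]
      ring
    have p1 : PolyBounded fun z : Fin d → ℝ => (a ⬝ᵥ z) * (b ⬝ᵥ z) :=
      .mul (.dotProduct_left a) (.dotProduct_left b)
    have p2 := PolyBounded.dotProduct_left ((a ⬝ᵥ c) • b + (b ⬝ᵥ c) • a)
    simp_rw [h]
    rw [integral_add ((p1.add p2).integrable hR) (integrable_const _),
      integral_add (p1.integrable hR) (p2.integrable hR), integral_dotProduct_mul_gaussN hR,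
      integral_dotProduct_gaussN hR, integral_const, probReal_univ, one_smul, add_zero,
      mul_inv_Vm_eq hσ hS, hc]
    have h3 (v : Fin d → ℝ) : v ⬝ᵥ (S *ᵥ ((Vm σ S)⁻¹ *ᵥ x)) = (S *ᵥ v) ⬝ᵥ ((Vm σ S)⁻¹ *ᵥ x) := by
      rw [dotProduct_mulVec_comm_of_symm hS.transpose_eq, dotProduct_comm]
    have h4 : a ⬝ᵥ ((S * (Vm σ S)⁻¹ * S) *ᵥ b) = (S *ᵥ a) ⬝ᵥ ((Vm σ S)⁻¹ *ᵥ (S *ᵥ b)) := by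
      rw [mul_assoc, ← mulVec_mulVec, ← mulVec_mulVec,
        dotProduct_mulVec_comm_of_symm hS.transpose_eq, dotProduct_comm]
    simp only [sub_mulVec, smul_mulVec, vecMulVec_mulVec, dotProduct_sub, dotProduct_smul,
      smul_eq_mul, h3, h4, op_smul_eq_smul,
      dotProduct_comm ((Vm σ S)⁻¹ *ᵥ x) (S *ᵥ b)]
    ring

/-- `T4 · y` is the orthogonal projection of `T2 · y` onto the quadratic polynomials. -/
lemma integral_T2_mul_quadPoly (hσ : 0 < σ) (hS : S.PosDef) (y : Fin d → ℝ) (κ : ℝ)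
    (β : Fin d → ℝ) (N : Matrix (Fin d) (Fin d) ℝ) :
    ∫ x, T2 σ 0 S x y * quadPoly κ β N x ∂(gaussN 0 S)
      = ∫ x, T4 σ 0 S x y * quadPoly κ β N x ∂(gaussN 0 S) := by
  have hR := posDef_tiltCov hσ hS
  have hV := (posDef_Vm hσ hS).det_pos
  have hW := (posDef_Vm (by positivity : 0 < 2 * σ) hS).det_pos
  have hU := (posDef_Vm hσ hS).inv.transpose_eq
  have hQ := (posDef_Vm (by positivity : 0 < 2 * σ) hS).inv.transpose_eq
  have hB : (Bm 0 S y)ᵀ = Bm 0 S y := by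
    rw [Bm, transpose_sub, transpose_vecMulVec, hS.transpose_eq]
  have hUR := inv_Vm_mul_tiltCov hσ hS
  have hR' := tiltCov_eq hσ hS
  have hQ' := inv_Vm_two_mul_eq hσ hS
  have key (f : (Fin d → ℝ) → ℝ) : ∫ x, T2 σ 0 S x y * f x ∂(gaussN 0 S)
      = (Vm (2 * σ) S).det ^ (-(1 : ℝ) / 2) * ∫ x,
        quadPoly (1 - σ * ((Vm σ S)⁻¹ * Bm 0 S y).trace) ((2 * σ) • ((Vm σ S)⁻¹ *ᵥ y))
          ((2 * σ ^ 2) • ((Vm σ S)⁻¹ * Bm 0 S y * (Vm σ S)⁻¹)) x * f x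
          ∂(gaussN 0 (tiltCov σ S)) := by
    have h := integral_exp_mul_gaussN hS hR (div_pos hW hV) (inv_tiltCov hσ hS) (det_tiltCov hσ hS)
      0 fun x => quadPoly (1 - σ * ((Vm σ S)⁻¹ * Bm 0 S y).trace) ((2 * σ) • ((Vm σ S)⁻¹ *ᵥ y))
          ((2 * σ ^ 2) • ((Vm σ S)⁻¹ * Bm 0 S y * (Vm σ S)⁻¹)) x * f x
    simp only [zero_dotProduct, add_zero, mulVec_zero, zero_div, exp_zero, mul_one] at h
    simp_rw [T2_eq_quadPoly_left, mul_assoc]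
    rw [integral_const_mul, ← mul_assoc, h, div_rpow hW.le hV.le, ← mul_assoc,
      mul_div_cancel₀ _ (rpow_pos_of_pos hV _).ne']
  have hquad (x : Fin d → ℝ) := T4_eq_quadPoly hσ hS x y
  set U := (Vm σ S)⁻¹
  set Q := (Vm (2 * σ) S)⁻¹
  set B := Bm 0 S y
  set R := tiltCov σ S
  set t := (B * Q).trace with ht
  have hM' : ((2 * σ ^ 2) • (U * B * U))ᵀ = (2 * σ ^ 2) • (U * B * U) := by
    simp only [transpose_smul, transpose_mul, hU, hB, mul_assoc]
  have hM : ((-σ + σ ^ 2 * t) • Q + (2 * σ ^ 2) • (Q * B * Q))ᵀ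
      = (-σ + σ ^ 2 * t) • Q + (2 * σ ^ 2) • (Q * B * Q) := by
    simp only [transpose_add, transpose_smul, transpose_mul, hQ, hB, mul_assoc]
  have htr : 1 - σ * (U * B).trace + ((2 * σ ^ 2) • (U * B * U) * R).trace = 1 - σ * t := by
    have h : (U * B * U * R).trace = (B * (Q * S * U)).trace := by
      rw [mul_assoc, hUR, mul_assoc, trace_mul_comm, mul_assoc]
    rw [ht, hQ', smul_mul, trace_smul, h, mul_sub, trace_sub, Matrix.mul_smul, trace_smul,
      trace_mul_comm U B, smul_eq_mul, smul_eq_mul]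
    ring
  have hRU (v : Fin d → ℝ) : U *ᵥ (R *ᵥ v) = Q *ᵥ (S *ᵥ v) := by
    rw [mulVec_mulVec, hUR, mulVec_mulVec]
  refine integral_mul_quadPoly_congr hS ((polyBounded_T2 hσ hS).comp_prodMk_right y)
    (polyBounded_T4.comp_prodMk_right y) ?_ (fun a => ?_) (fun a b => ?_) κ β N
  · have h := key fun _ => 1
    simp only [mul_one] at h
    simp_rw [h, hquad]
    rw [integral_const_mul, integral_quadPoly _ _ hS, integral_quadPoly _ _ hR, htr]
    ring
  · rw [key]
    simp_rw [hquad, mul_assoc _ (quadPoly _ _ _ _)]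
    rw [integral_const_mul, integral_quadPoly_mul_dotProduct _ _ hS,
      integral_quadPoly_mul_dotProduct _ _ hR, smul_dotProduct, smul_dotProduct,
      dotProduct_comm (U *ᵥ y), dotProduct_comm (Q *ᵥ y), dotProduct_mulVec_comm_of_symm hU, hRU,
      dotProduct_mulVec_comm_of_symm hQ]
  · rw [key]
    simp_rw [hquad, mul_assoc _ (quadPoly _ _ _ _)]
    rw [integral_const_mul, integral_quadPoly_mul_dotProduct_mul _ _ hS hM,
      integral_quadPoly_mul_dotProduct_mul _ _ hR hM', htr]
    have h1 : (R *ᵥ a) ⬝ᵥ ((U * B * U) *ᵥ (R *ᵥ b))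
        = (S *ᵥ a) ⬝ᵥ ((Q * B * Q) *ᵥ (S *ᵥ b)) := by
      simp only [← mulVec_mulVec, hRU]
      rw [dotProduct_mulVec_comm_of_symm hU, hRU, dotProduct_mulVec_comm_of_symm hQ]
    have h2 : a ⬝ᵥ (R *ᵥ b) = a ⬝ᵥ (S *ᵥ b) - 2 * σ * ((S *ᵥ a) ⬝ᵥ (Q *ᵥ (S *ᵥ b))) := by
      rw [hR', sub_mulVec, smul_mulVec, dotProduct_sub, dotProduct_smul, mul_assoc,
        ← mulVec_mulVec, ← mulVec_mulVec,
        dotProduct_mulVec_comm_of_symm hS.transpose_eq a (Q *ᵥ _), dotProduct_comm _ (S *ᵥ a),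
        smul_eq_mul]
    simp only [smul_mulVec, add_mulVec, dotProduct_add, dotProduct_smul, smul_eq_mul, h1, h2]
    ring

end Projection

section DoubleIntegral

variable {d : ℕ} {S : Matrix (Fin d) (Fin d) ℝ} {σ : ℝ}

lemma T2_add_add (m x y : Fin d → ℝ) : T2 σ m S (x + m) (y + m) = T2 σ 0 S x y := by
  simp [T2, Bm]

lemma T4_add_add (m x y : Fin d → ℝ) : T4 σ m S (x + m) (y + m) = T4 σ 0 S x y := by
  simp [T4, Bm]

lemma integral_integral_gaussN_translate (m : Fin d → ℝ) (hS : S.PosDef)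
    {g h : (Fin d → ℝ) → (Fin d → ℝ) → ℝ} (hgh : ∀ x y, g (x + m) (y + m) = h x y) :
    ∫ y, (∫ x, g x y ∂(gaussN m S)) ∂(gaussN m S)
      = ∫ y, (∫ x, h x y ∂(gaussN 0 S)) ∂(gaussN 0 S) := by
  rw [integral_gaussN_translate m hS]
  congr 1 with y
  rw [integral_gaussN_translate m hS]
  simp_rw [hgh]

lemma PolyBounded.integral_integral_swap {g : (Fin d → ℝ) → (Fin d → ℝ) → ℝ}
    (hg : PolyBounded fun p : (Fin d → ℝ) × (Fin d → ℝ) => g p.1 p.2) (hS : S.PosDef) :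
    ∫ y, (∫ x, g x y ∂(gaussN 0 S)) ∂(gaussN 0 S)
      = ∫ x, (∫ y, g x y ∂(gaussN 0 S)) ∂(gaussN 0 S) := by
  have := isProbabilityMeasure_gaussN 0 hS
  exact (MeasureTheory.integral_integral_swap (hg.integrable_prod hS)).symm

lemma integral_mul_congr_of_eq_quadPoly {f g p : (Fin d → ℝ) → ℝ} {μ : Measure (Fin d → ℝ)}
    (hfg : ∀ κ β N, ∫ z, f z * quadPoly κ β N z ∂μ = ∫ z, g z * quadPoly κ β N z ∂μ)
    {c κ : ℝ} {β : Fin d → ℝ} {N : Matrix (Fin d) (Fin d) ℝ}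
    (hp : ∀ z, p z = c * quadPoly κ β N z) : ∫ z, f z * p z ∂μ = ∫ z, g z * p z ∂μ := by
  simp_rw [hp, mul_left_comm _ c]
  rw [integral_const_mul, integral_const_mul, hfg]

end DoubleIntegral

/-- Lemma 8 (cross-moment equalities): writing `∬ g` for
`∫∫ g(x,y) dN(m₀,Σ₀)(x) dN(m₀,Σ₀)(y)`, one has
`∬ T₂² = ∬ T₃² = ∬ T₁T₂ = ∬ T₁T₃` and `∬ T₄² = ∬ T₁T₄ = ∬ T₂T₃ = ∬ T₂T₄ = ∬ T₃T₄`. -/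
theorem cross_moment_equalities {d : ℕ} (hd : 1 ≤ d) (σ : ℝ) (hσ : 0 < σ)
    (m₀ : Fin d → ℝ) (S : Matrix (Fin d) (Fin d) ℝ) (hS : S.PosDef) :
    let DI : ((Fin d → ℝ) → (Fin d → ℝ) → ℝ) → ℝ :=
      fun g => ∫ y, (∫ x, g x y ∂(gaussN m₀ S)) ∂(gaussN m₀ S)
    (DI (fun x y => T2 σ m₀ S x y * T2 σ m₀ S x y) =
        DI (fun x y => T3 σ m₀ S x y * T3 σ m₀ S x y) ∧
      DI (fun x y => T3 σ m₀ S x y * T3 σ m₀ S x y) =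
        DI (fun x y => T1 σ x y * T2 σ m₀ S x y) ∧
      DI (fun x y => T1 σ x y * T2 σ m₀ S x y) =
        DI (fun x y => T1 σ x y * T3 σ m₀ S x y)) ∧
    (DI (fun x y => T4 σ m₀ S x y * T4 σ m₀ S x y) =
        DI (fun x y => T1 σ x y * T4 σ m₀ S x y) ∧
      DI (fun x y => T1 σ x y * T4 σ m₀ S x y) =
        DI (fun x y => T2 σ m₀ S x y * T3 σ m₀ S x y) ∧
      DI (fun x y => T2 σ m₀ S x y * T3 σ m₀ S x y) =
        DI (fun x y => T2 σ m₀ S x y * T4 σ m₀ S x y) ∧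
      DI (fun x y => T2 σ m₀ S x y * T4 σ m₀ S x y) =
        DI (fun x y => T3 σ m₀ S x y * T4 σ m₀ S x y)) := by
  intro DI
  have tr {g h : (Fin d → ℝ) → (Fin d → ℝ) → ℝ} (hgh : ∀ x y, g (x + m₀) (y + m₀) = h x y) :
      DI g = ∫ y, (∫ x, h x y ∂(gaussN 0 S)) ∂(gaussN 0 S) :=
    integral_integral_gaussN_translate m₀ hS hgh
  have t1 (x y : Fin d → ℝ) : T1 σ (x + m₀) (y + m₀) = T1 σ x y := by simp [T1]
  have t3 (x y : Fin d → ℝ) : T3 σ m₀ S (x + m₀) (y + m₀) = T2 σ 0 S y x := T2_add_add _ _ _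
  rw [tr fun x y => by rw [T2_add_add], tr fun x y => by rw [t3],
    tr fun x y => by rw [t1, T2_add_add], tr fun x y => by rw [t1, t3],
    tr fun x y => by rw [T4_add_add], tr fun x y => by rw [t1, T4_add_add],
    tr fun x y => by rw [T2_add_add, t3], tr fun x y => by rw [T2_add_add, T4_add_add],
    tr fun x y => by rw [t3, T4_add_add]]
  have p1 := polyBounded_T1 (d := d) hσ
  have p2 := polyBounded_T2 hσ hS
  have p4 := polyBounded_T4 (σ := σ) (S := S)
  have h12 (x : Fin d → ℝ) : ∫ y, T1 σ x y * T2 σ 0 S x y ∂(gaussN 0 S)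
      = ∫ y, T2 σ 0 S x y * T2 σ 0 S x y ∂(gaussN 0 S) :=
    integral_mul_congr_of_eq_quadPoly (integral_T1_mul_quadPoly hσ hS x)
      (T2_eq_quadPoly_right hσ hS x)
  have h14 (x : Fin d → ℝ) : ∫ y, T1 σ x y * T4 σ 0 S x y ∂(gaussN 0 S)
      = ∫ y, T2 σ 0 S x y * T4 σ 0 S x y ∂(gaussN 0 S) :=
    integral_mul_congr_of_eq_quadPoly (integral_T1_mul_quadPoly hσ hS x)
      fun y => (T4_comm hσ hS x y).trans (T4_eq_quadPoly hσ hS y x)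
  have h24 (y : Fin d → ℝ) : ∫ x, T2 σ 0 S x y * T4 σ 0 S x y ∂(gaussN 0 S)
      = ∫ x, T4 σ 0 S x y * T4 σ 0 S x y ∂(gaussN 0 S) :=
    integral_mul_congr_of_eq_quadPoly (integral_T2_mul_quadPoly hσ hS y)
      fun x => T4_eq_quadPoly hσ hS x y
  have h23 (y : Fin d → ℝ) : ∫ x, T2 σ 0 S x y * T2 σ 0 S y x ∂(gaussN 0 S)
      = ∫ x, T4 σ 0 S x y * T2 σ 0 S y x ∂(gaussN 0 S) :=
    integral_mul_congr_of_eq_quadPoly (integral_T2_mul_quadPoly hσ hS y)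
      (T2_eq_quadPoly_right hσ hS y)
  have s22 := PolyBounded.integral_integral_swap (g := fun x y => T2 σ 0 S x y * T2 σ 0 S x y)
    (p2.mul p2) hS
  have s12 := PolyBounded.integral_integral_swap (g := fun x y => T1 σ x y * T2 σ 0 S x y)
    (p1.mul p2) hS
  have s14 := PolyBounded.integral_integral_swap (g := fun x y => T1 σ x y * T4 σ 0 S x y)
    (p1.mul p4) hS
  have s24 := PolyBounded.integral_integral_swap (g := fun x y => T2 σ 0 S x y * T4 σ 0 S x y)
    (p2.mul p4) hS
  have e34 : ∫ y, (∫ x, T2 σ 0 S y x * T4 σ 0 S x y ∂(gaussN 0 S)) ∂(gaussN 0 S)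
      = ∫ y, (∫ x, T2 σ 0 S x y * T4 σ 0 S x y ∂(gaussN 0 S)) ∂(gaussN 0 S) := by
    rw [s24]
    congr! 5 with y x
    exact T4_comm hσ hS x y
  have e14 : ∫ y, (∫ x, T1 σ x y * T4 σ 0 S x y ∂(gaussN 0 S)) ∂(gaussN 0 S)
      = ∫ y, (∫ x, T2 σ 0 S x y * T4 σ 0 S x y ∂(gaussN 0 S)) ∂(gaussN 0 S) := by
    rw [s14, s24]
    simp_rw [h14]
  have e23 : ∫ y, (∫ x, T2 σ 0 S x y * T2 σ 0 S y x ∂(gaussN 0 S)) ∂(gaussN 0 S)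
      = ∫ y, (∫ x, T2 σ 0 S x y * T4 σ 0 S x y ∂(gaussN 0 S)) ∂(gaussN 0 S) := by
    simp_rw [h23, ← e34, mul_comm (T4 _ _ _ _ _)]
  have e12 : ∫ x, (∫ y, T1 σ x y * T2 σ 0 S x y ∂(gaussN 0 S)) ∂(gaussN 0 S)
      = ∫ x, (∫ y, T2 σ 0 S x y * T2 σ 0 S x y ∂(gaussN 0 S)) ∂(gaussN 0 S) := by
    simp_rw [h12]
  refine ⟨⟨s22, (s12.trans e12).symm, s12.trans ?_⟩, ?_, e14.trans e23.symm, e23, e34.symm⟩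
  · congr! 5 with x y
    exact T1_comm x y
  · rw [e14]
    simp_rw [h24]
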